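/- For every K > 0 there exists λ > 0, depending only on K, with the following property: for every 1-periodic C² function F : ℝ³ → ℝ with ‖F‖_{C²} ≤ K and ∫_{[0,1]³} e^F dV = 1, every u ∈ C̃⁴(T³) solving the reduced Calabi–Yau equation (u_xx + 1)(u_yy + u_tt + u_t + 1) − u_xy² − u_xt² = e^F, every point of ℝ³ and every (ξ, η, τ) ∈ ℝ³: (u_xx + 1)(η² + τ²) + (u_yy + u_tt + u_t + 1)ξ² − 2 u_xy ξη − 2 u_xt ξτ ≥ λ (ξ² + η² + τ²). In other words, the reduced Calabi–Yau equation is uniformly elliptic on the set of all its C̃⁴ solutions. -/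

import Mathlib

open MeasureTheory

noncomputable section

/-- Points of `ℝ³`, written as `ℝ × ℝ × ℝ`. -/
abbrev R3 := ℝ × ℝ × ℝ

/-- The coordinate direction `x`. -/
def vx : R3 := (1, 0, 0)
/-- The coordinate direction `y`. -/
def vy : R3 := (0, 1, 0)
/-- The coordinate direction `t`. -/
def vt : R3 := (0, 0, 1)

/-- Partial (directional) derivative in the direction `e`. -/
def pd (e : R3) (u : R3 → ℝ) : R3 → ℝ := fun p => fderiv ℝ u p e

/-- `1`-periodicity in each of the three variables. -/
def Periodic3 (u : R3 → ℝ) : Prop :=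
  ∀ p : R3, u (p + vx) = u p ∧ u (p + vy) = u p ∧ u (p + vt) = u p

/-- The unit cube `[0,1]³`. -/
def cube : Set R3 := Set.Icc (0, 0, 0) (1, 1, 1)

/-- Zero mean over the unit cube. -/
def ZeroMean (u : R3 → ℝ) : Prop := ∫ p in cube, u p = 0

/-- The reduced Calabi–Yau equation
`(u_xx + 1)(u_yy + u_tt + u_t + 1) − u_xy² − u_xt² = e^F` on `ℝ³`. -/
def CYeq (F u : R3 → ℝ) : Prop :=
  ∀ p : R3,
    (pd vx (pd vx u) p + 1)
        * (pd vy (pd vy u) p + pd vt (pd vt u) p + pd vt u p + 1)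
      - (pd vy (pd vx u) p) ^ 2 - (pd vt (pd vx u) p) ^ 2 = Real.exp (F p)

/-- The Euclidean norm on `ℝ³ = ℝ × ℝ × ℝ`. -/
def enorm3 (h : R3) : ℝ := Real.sqrt (h.1 ^ 2 + h.2.1 ^ 2 + h.2.2 ^ 2)

/-- `‖F‖_{C²} ≤ K`: all partial derivatives of `F` of order `≤ 2` are bounded by `K`. -/
def C2Bound (F : R3 → ℝ) (K : ℝ) : Prop :=
  ∀ p : R3, |F p| ≤ K ∧
    (∀ e ∈ ({vx, vy, vt} : Set R3), |pd e F p| ≤ K) ∧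
    (∀ e ∈ ({vx, vy, vt} : Set R3), ∀ e' ∈ ({vx, vy, vt} : Set R3),
      |pd e (pd e' F) p| ≤ K)

section Calculus

variable {f g u : R3 → ℝ}

lemma contDiff_pd {n m : WithTop ℕ∞} (hu : ContDiff ℝ n u) (h : m + 1 ≤ n) (e : R3) :
    ContDiff ℝ m (pd e u) :=
  (hu.fderiv_right h).clm_apply contDiff_const

lemma pd_add (hf : Differentiable ℝ f) (hg : Differentiable ℝ g) (e : R3) :
    pd e (fun p => f p + g p) = fun p => pd e f p + pd e g p := by
  funext p
  simp [pd, fderiv_fun_add (hf p) (hg p)]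

lemma pd_sub (hf : Differentiable ℝ f) (hg : Differentiable ℝ g) (e : R3) :
    pd e (fun p => f p - g p) = fun p => pd e f p - pd e g p := by
  funext p
  simp [pd, fderiv_fun_sub (hf p) (hg p)]

lemma pd_add_const (c : ℝ) (e : R3) : pd e (fun p => f p + c) = pd e f := by
  funext p
  simp [pd]

lemma pd_const (c : ℝ) (e : R3) : pd e (fun _ => c) = fun _ => 0 := by
  funext p
  simp [pd]

lemma pd_comm (hu : ContDiff ℝ 2 u) (e d : R3) : pd e (pd d u) = pd d (pd e u) := by
  funext p
  have hd : DifferentiableAt ℝ (fderiv ℝ u) p :=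
    (hu.fderiv_right (m := 1) (by norm_num)).differentiable (by norm_num) p
  have key : ∀ v w : R3, pd v (pd w u) p = fderiv ℝ (fderiv ℝ u) p v w := by
    intro v w
    have h := (hd.hasFDerivAt.clm_apply (hasFDerivAt_const w p)).fderiv
    change fderiv ℝ (fun q => fderiv ℝ u q w) p v = _
    rw [h]
    simp
  rw [key, key]
  exact (hu.contDiffAt.isSymmSndFDerivAt (by simp)) e d

lemma pd_pd_add (hf : ContDiff ℝ 2 f) (hg : ContDiff ℝ 2 g) (e d : R3) :
    pd e (pd d (fun p => f p + g p)) = fun p => pd e (pd d f) p + pd e (pd d g) p := by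
  rw [pd_add (hf.differentiable (by norm_num)) (hg.differentiable (by norm_num)),
    pd_add ((contDiff_pd (m := 1) hf (by norm_num) d).differentiable (by norm_num))
      ((contDiff_pd (m := 1) hg (by norm_num) d).differentiable (by norm_num))]

lemma pd_pd_sub (hf : ContDiff ℝ 2 f) (hg : ContDiff ℝ 2 g) (e d : R3) :
    pd e (pd d (fun p => f p - g p)) = fun p => pd e (pd d f) p - pd e (pd d g) p := by
  rw [pd_sub (hf.differentiable (by norm_num)) (hg.differentiable (by norm_num)),
    pd_sub ((contDiff_pd (m := 1) hf (by norm_num) d).differentiable (by norm_num))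
      ((contDiff_pd (m := 1) hg (by norm_num) d).differentiable (by norm_num))]

lemma pd_comm_three (hu : ContDiff ℝ 4 u) (e d d' : R3) :
    pd e (pd d (pd d' u)) = pd d (pd d' (pd e u)) := by
  rw [pd_comm (contDiff_pd hu (by norm_num) d') e d,
    pd_comm (hu.of_le (by norm_num)) e d']

lemma pd_comm_four (hu : ContDiff ℝ 4 u) (e d d' : R3) :
    pd e (pd e (pd d (pd d' u))) = pd d (pd d' (pd e (pd e u))) := by
  have h3 : ContDiff ℝ 3 (pd e u) := contDiff_pd hu (by norm_num) e
  rw [pd_comm_three hu e d d', pd_comm (contDiff_pd h3 (by norm_num) d') e d,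
    pd_comm (h3.of_le (by norm_num)) e d']

/-- The derivative of a function along a line is its directional derivative. -/
lemma hasDerivAt_line (hf : Differentiable ℝ f) (p e : R3) (s : ℝ) :
    HasDerivAt (fun s : ℝ => f (p + s • e)) (pd e f (p + s • e)) s := by
  have hl : HasDerivAt (fun s : ℝ => p + s • e) e s := by
    simpa using ((hasDerivAt_id s).smul_const e).const_add p
  exact (hf (p + s • e)).hasFDerivAt.comp_hasDerivAt s hl

lemma pd_combo (f : R3 → ℝ) (a b : ℝ) (e d : R3) :
    pd (a • e + b • d) f = fun p => a * pd e f p + b * pd d f p := by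
  funext p
  simp [pd]

lemma pd_pd_combo (hf : ContDiff ℝ 2 f) (a b : ℝ) (e d p : R3) :
    pd (a • e + b • d) (pd (a • e + b • d) f) p
      = a ^ 2 * pd e (pd e f) p + 2 * a * b * pd d (pd e f) p + b ^ 2 * pd d (pd d f) p := by
  have h : ∀ v : R3, pd v (pd (a • e + b • d) f) p = a * pd v (pd e f) p + b * pd v (pd d f) p := by
    intro v
    have hd : ∀ w, DifferentiableAt ℝ (pd w f) p := fun w =>
      (contDiff_pd (m := 1) hf (by norm_num) w).differentiable (by norm_num) p
    rw [pd_combo]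
    change fderiv ℝ (fun q => a * pd e f q + b * pd d f q) p v = _
    rw [fderiv_fun_add ((hd e).const_mul a) ((hd d).const_mul b),
      fderiv_const_mul (hd e), fderiv_const_mul (hd d)]
    simp [pd]
  rw [pd_combo (pd (a • e + b • d) f)]
  simp only [h, pd_comm hf e d]
  ring

/-- A function with positive second derivative at a point has no local maximum there. -/
lemma second_deriv_nonpos_of_isLocalMax {φ φ' : ℝ → ℝ} {s c : ℝ}
    (h1 : ∀ᶠ r in nhds s, HasDerivAt φ (φ' r) r) (h2 : HasDerivAt φ' c s)
    (hmax : IsLocalMax φ s) : c ≤ 0 := by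
  by_contra! hc
  have hd : deriv φ =ᶠ[nhds s] φ' := h1.mono fun r hr => hr.deriv
  have hdd : deriv (deriv φ) s = c := by rw [hd.deriv_eq, h2.deriv]
  have hmin : IsLocalMin φ s :=
    isLocalMin_of_deriv_deriv_pos (by rwa [hdd]) hmax.deriv_eq_zero h1.self_of_nhds.continuousAt
  have hconst : φ =ᶠ[nhds s] fun _ => φ s := by
    filter_upwards [hmax, hmin] with r h h' using le_antisymm h h'
  have : deriv φ =ᶠ[nhds s] fun _ => 0 := by
    simpa using hconst.deriv
  rw [this.deriv_eq] at hdd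
  simp at hdd
  exact hc.ne hdd

lemma pd_eq_zero_of_max {p : R3} (hmax : ∀ q, f q ≤ f p) (e : R3) : pd e f p = 0 := by
  have h : IsLocalMax f p := Filter.Eventually.of_forall hmax
  simp [pd, h.fderiv_eq_zero]

lemma pd_pd_nonpos_of_max (hf : ContDiff ℝ 2 f) {p : R3} (hmax : ∀ q, f q ≤ f p) (e : R3) :
    pd e (pd e f) p ≤ 0 := by
  have h2 := hasDerivAt_line ((contDiff_pd (m := 1) hf (by norm_num) e).differentiable
    (by norm_num)) p e 0
  have := second_deriv_nonpos_of_isLocalMax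
    (Filter.Eventually.of_forall (hasDerivAt_line (hf.differentiable (by norm_num)) p e)) h2
    (Filter.Eventually.of_forall fun s => by simpa using hmax _)
  simpa using this

end Calculus

section Periodicity

variable {f : R3 → ℝ}

lemma Periodic3.pd (hf : Periodic3 f) (e : R3) : Periodic3 (pd e f) := by
  have key : ∀ v, (∀ p, f (p + v) = f p) → ∀ p, _root_.pd e f (p + v) = _root_.pd e f p := by
    intro v hv p
    have h := fderiv_comp_add_right (𝕜 := ℝ) (f := f) (x := p) v
    simp only [hv] at h
    simp only [_root_.pd]
    rw [← h]
  exact fun p => ⟨key vx (fun q => (hf q).1) p, key vy (fun q => (hf q).2.1) p,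
    key vt (fun q => (hf q).2.2) p⟩

lemma exists_unit_shift {e : R3} (he : ∀ p, f (p + e) = f p) (p : R3) (r : ℝ) :
    ∃ s ∈ Set.Ico (0 : ℝ) 1, f (p + r • e) = f (p + s • e) := by
  have h : Function.Periodic (fun s : ℝ => f (p + s • e)) 1 := fun s => by
    simp only [add_smul, one_smul, ← add_assoc, he]
  exact h.exists_mem_Ico₀ one_pos r

lemma Periodic3.exists_mem_cube (hf : Periodic3 f) (p : R3) : ∃ q ∈ cube, f q = f p := by
  obtain ⟨x, y, t⟩ := p
  obtain ⟨c, hc, h3⟩ := exists_unit_shift (fun q => (hf q).2.2) (x, y, 0) t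
  obtain ⟨b, hb, h2⟩ := exists_unit_shift (fun q => (hf q).2.1) (x, 0, c) y
  obtain ⟨a, ha, h1⟩ := exists_unit_shift (fun q => (hf q).1) (0, b, c) x
  refine ⟨(a, b, c), ?_, ?_⟩
  · simp [cube, Prod.le_def, ha.1, hb.1, hc.1, ha.2.le, hb.2.le, hc.2.le]
  · simp [vx, vy, vt] at h1 h2 h3
    rw [h3, h2, h1]

lemma Periodic3.exists_max (hf : Periodic3 f) (hc : Continuous f) : ∃ p, ∀ q, f q ≤ f p := by
  obtain ⟨p, -, hp⟩ := (isCompact_Icc (a := ((0, 0, 0) : R3)) (b := (1, 1, 1))).exists_isMaxOn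
    ⟨0, by simp [Prod.le_def]⟩ hc.continuousOn
  refine ⟨p, fun q => ?_⟩
  obtain ⟨q', hq', h⟩ := hf.exists_mem_cube q
  exact h ▸ hp hq'

end Periodicity

section Oscillation

variable {v : R3 → ℝ}

/-- Two-point maximum principle: if `v_ee + v_dd + v_d'` oscillates by less than `S`, then the
symmetric difference of `v` in the periodic direction `e` is controlled by `S`. -/
lemma symm_diff_le (hv : ContDiff ℝ 2 v) (hp : Periodic3 v) {e : R3}
    (he : ∀ p, v (p + e) = v p) (d d' : R3) {S : ℝ}
    (hS : ∀ p q, pd e (pd e v) p + pd d (pd d v) p + pd d' v p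
      - (pd e (pd e v) q + pd d (pd d v) q + pd d' v q) < S)
    (p : R3) {r : ℝ} (hr : r ∈ Set.Icc (0 : ℝ) (1 / 2)) :
    v (p + r • e) - v (p - r • e) ≤ S * (r * (1 / 2 - r)) := by
  have hvc := hv.continuous
  have hS0 : 0 < S := by simpa using hS 0 0
  set w : R3 × ℝ → ℝ := fun z =>
    v (z.1 + z.2 • e) - v (z.1 - z.2 • e) - S * (z.2 * (1 / 2 - z.2)) with hw
  have hwc : Continuous w := by fun_prop
  have hcomp : IsCompact (cube ×ˢ Set.Icc (0 : ℝ) (1 / 2)) := isCompact_Icc.prod isCompact_Icc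
  obtain ⟨⟨p₀, h₀⟩, ⟨-, hh₀⟩, hmax⟩ := hcomp.exists_isMaxOn
    ⟨(0, 0), by constructor <;> simp [cube, Prod.le_def]⟩ hwc.continuousOn
  have hmax' : ∀ q, ∀ h ∈ Set.Icc (0 : ℝ) (1 / 2), w (q, h) ≤ w (p₀, h₀) := by
    intro q h hh
    have hper : Periodic3 fun q => w (q, h) := by
      intro q
      simp only [hw, add_right_comm q _ (h • e), add_sub_right_comm q _ (h • e)]
      exact ⟨by rw [(hp _).1, (hp _).1], by rw [(hp _).2.1, (hp _).2.1],
        by rw [(hp _).2.2, (hp _).2.2]⟩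
    obtain ⟨q', hq', hqq⟩ := hper.exists_mem_cube q
    exact hqq ▸ hmax ⟨hq', hh⟩
  suffices hle : w (p₀, h₀) ≤ 0 by
    have := (hmax' p r hr).trans hle
    simp only [hw] at this
    linarith
  by_contra! hpos
  have h0 : h₀ ≠ 0 := by
    rintro rfl
    simp [hw] at hpos
  have h1 : h₀ ≠ 1 / 2 := by
    rintro rfl
    have : p₀ + (1 / 2 : ℝ) • e = p₀ - (1 / 2 : ℝ) • e + e := by module
    simp only [hw] at hpos
    rw [this, he] at hpos
    simp at hpos
  have hmem : h₀ ∈ Set.Ioo (0 : ℝ) (1 / 2) :=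
    ⟨lt_of_le_of_ne hh₀.1 (Ne.symm h0), lt_of_le_of_ne hh₀.2 h1⟩
  -- derivatives in the base point
  have hshift : ∀ (g : R3 → ℝ) (c k : R3), pd k (fun q => g (q + c)) = fun q => pd k g (q + c) := by
    intro g c k
    funext q
    simp [pd, fderiv_comp_add_right]
  set a := h₀ • e with ha
  set ω : R3 → ℝ := fun q => v (q + a) - v (q + -a) with hω
  have hc1 : ContDiff ℝ 2 fun q => v (q + a) := hv.comp (contDiff_id.add contDiff_const)
  have hc2 : ContDiff ℝ 2 fun q => v (q + -a) := hv.comp (contDiff_id.add contDiff_const)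
  have hωmax : ∀ q, ω q ≤ ω p₀ := by
    intro q
    have := hmax' q h₀ hh₀
    simp only [hw, ← ha, sub_eq_add_neg (G := R3)] at this
    simp only [hω]
    linarith
  have e1 : pd d' v (p₀ + a) - pd d' v (p₀ + -a) = 0 := by
    have := pd_eq_zero_of_max hωmax d'
    rw [hω, pd_sub (hc1.differentiable (by norm_num)) (hc2.differentiable (by norm_num)),
      hshift, hshift] at this
    exact this
  have e2 : pd d (pd d v) (p₀ + a) - pd d (pd d v) (p₀ + -a) ≤ 0 := by
    have : pd d (pd d ω) p₀ ≤ 0 := pd_pd_nonpos_of_max (hc1.sub hc2) hωmax d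
    rw [hω, pd_pd_sub hc1 hc2, hshift, hshift, hshift, hshift] at this
    exact this
  -- derivatives in the separation
  have hline : ∀ (g : R3 → ℝ), Differentiable ℝ g → ∀ s : ℝ,
      HasDerivAt (fun s : ℝ => g (p₀ - s • e)) (-pd e g (p₀ - s • e)) s := by
    intro g hg s
    have := hasDerivAt_line hg p₀ (-e) s
    simpa [pd, sub_eq_add_neg] using this
  have hd1 : Differentiable ℝ (pd e v) :=
    (contDiff_pd (m := 1) hv (by norm_num) e).differentiable (by norm_num)
  have hd0 : Differentiable ℝ v := hv.differentiable (by norm_num)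
  have hq1 : ∀ s : ℝ, HasDerivAt (fun s : ℝ => S * (s * (1 / 2 - s))) (S * (1 / 2 - 2 * s)) s := by
    intro s
    refine (((hasDerivAt_id' s).fun_mul ((hasDerivAt_id' s).const_sub (1 / 2))).const_mul
      S).congr_deriv ?_
    ring
  have hq2 : HasDerivAt (fun s : ℝ => S * (1 / 2 - 2 * s)) (-(2 * S)) h₀ := by
    refine ((((hasDerivAt_id' h₀).const_mul 2).const_sub (1 / 2)).const_mul S).congr_deriv ?_
    ring
  have hloc : IsLocalMax (fun s : ℝ => w (p₀, s)) h₀ := by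
    filter_upwards [isOpen_Ioo.mem_nhds hmem] with s hs
    exact hmax' p₀ s ⟨hs.1.le, hs.2.le⟩
  have e3 := second_deriv_nonpos_of_isLocalMax
    (Filter.Eventually.of_forall fun s =>
      ((hasDerivAt_line hd0 p₀ e s).sub (hline v hd0 s)).sub (hq1 s))
    (((hasDerivAt_line hd1 p₀ e h₀).sub (hline _ hd1 h₀).neg).sub hq2) hloc
  have := hS (p₀ - a) (p₀ + a)
  rw [sub_eq_add_neg p₀ a] at this
  simp only [← ha, sub_eq_add_neg p₀] at e3
  linarith

lemma line_diff_le (hv : ContDiff ℝ 2 v) (hp : Periodic3 v) {e : R3}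
    (he : ∀ p, v (p + e) = v p) (d d' : R3) {S : ℝ}
    (hS : ∀ p q, pd e (pd e v) p + pd d (pd d v) p + pd d' v p
      - (pd e (pd e v) q + pd d (pd d v) q + pd d' v q) < S)
    (p : R3) (r : ℝ) : v (p + r • e) ≤ v p + S / 16 := by
  have hS0 : 0 < S := by simpa using hS 0 0
  obtain ⟨s, hs, h⟩ := exists_unit_shift he p r
  have key := symm_diff_le hv hp he d d' hS (p + (s / 2) • e)
    (r := s / 2) ⟨by linarith [hs.1], by linarith [hs.2]⟩
  have e1 : p + (s / 2) • e + (s / 2) • e = p + s • e := by module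
  rw [e1, add_sub_cancel_right] at key
  rw [h]
  nlinarith [mul_nonneg hS0.le (sq_nonneg (s - 1 / 2))]

end Oscillation

section Equation

/-- Reversed Cauchy–Schwarz inequality for the Lorentzian form `PQ - a² - b²`. -/
lemma reversed_cauchy_schwarz {P Q a b p q α β : ℝ} (hP : 0 < P) (hf : 0 < P * Q - a ^ 2 - b ^ 2) :
    4 * (P * Q - a ^ 2 - b ^ 2) * (p * q - α ^ 2 - β ^ 2)
      ≤ (p * Q + P * q - 2 * a * α - 2 * b * β) ^ 2 := by
  have hP2 : 0 < P ^ 2 := by positivity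
  refine le_of_sub_nonneg (nonneg_of_mul_nonneg_right (b := _) ?_ hP2)
  have e : P ^ 2 * ((p * Q + P * q - 2 * a * α - 2 * b * β) ^ 2
      - 4 * (P * Q - a ^ 2 - b ^ 2) * (p * q - α ^ 2 - β ^ 2))
      = (P * (p * Q + P * q - 2 * a * α - 2 * b * β) - 2 * p * (P * Q - a ^ 2 - b ^ 2)) ^ 2
        + 4 * (P * Q - a ^ 2 - b ^ 2) * ((P * α - p * a) ^ 2 + (P * β - p * b) ^ 2) := by ring
  rw [e]
  positivity

variable {P Q a b F : R3 → ℝ}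

lemma first_variation (hP : Differentiable ℝ P) (hQ : Differentiable ℝ Q)
    (ha : Differentiable ℝ a) (hb : Differentiable ℝ b) (hF : Differentiable ℝ F)
    (heq : ∀ p, P p * Q p - a p ^ 2 - b p ^ 2 = Real.exp (F p)) (e p : R3) :
    pd e P p * Q p + P p * pd e Q p - 2 * a p * pd e a p - 2 * b p * pd e b p
      = Real.exp (F p) * pd e F p := by
  have h1 := (((hasDerivAt_line hP p e 0).fun_mul (hasDerivAt_line hQ p e 0)).fun_sub
    ((hasDerivAt_line ha p e 0).fun_pow 2)).fun_sub ((hasDerivAt_line hb p e 0).fun_pow 2)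
  have h2 := (hasDerivAt_line hF p e 0).exp
  simp only [heq] at h1
  have := h1.unique h2
  simp at this
  linarith

lemma second_variation (hP : ContDiff ℝ 2 P) (hQ : ContDiff ℝ 2 Q)
    (ha : ContDiff ℝ 2 a) (hb : ContDiff ℝ 2 b) (hF : ContDiff ℝ 2 F)
    (heq : ∀ p, P p * Q p - a p ^ 2 - b p ^ 2 = Real.exp (F p)) (hpos : ∀ p, 0 < P p) (e p : R3) :
    Real.exp (F p) * pd e (pd e F) p
      ≤ pd e (pd e P) p * Q p + P p * pd e (pd e Q) p
        - 2 * a p * pd e (pd e a) p - 2 * b p * pd e (pd e b) p := by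
  have d0 : ∀ {g : R3 → ℝ}, ContDiff ℝ 2 g → Differentiable ℝ g :=
    fun hg => hg.differentiable (by norm_num)
  have d1 : ∀ {g : R3 → ℝ}, ContDiff ℝ 2 g → Differentiable ℝ (pd e g) :=
    fun hg => (contDiff_pd (m := 1) hg (by norm_num) e).differentiable (by norm_num)
  have hfirst := first_variation (d0 hP) (d0 hQ) (d0 ha) (d0 hb) (d0 hF) heq e
  have l0 := fun {g : R3 → ℝ} (hg : ContDiff ℝ 2 g) => hasDerivAt_line (d0 hg) p e 0
  have l1 := fun {g : R3 → ℝ} (hg : ContDiff ℝ 2 g) => hasDerivAt_line (d1 hg) p e 0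
  have h1 := ((((l1 hP).fun_mul (l0 hQ)).fun_add ((l0 hP).fun_mul (l1 hQ))).fun_sub
    (((l0 ha).const_mul 2).fun_mul (l1 ha))).fun_sub (((l0 hb).const_mul 2).fun_mul (l1 hb))
  have h2 := (l0 hF).exp.fun_mul (l1 hF)
  simp only [hfirst] at h1
  have h3 := h1.unique h2
  simp only [zero_smul, add_zero] at h3
  have hf := Real.exp_pos (F p)
  have hcs := reversed_cauchy_schwarz (p := pd e P p) (q := pd e Q p) (α := pd e a p)
    (β := pd e b p) (hpos p) (heq p ▸ hf)
  rw [hfirst p, heq p] at hcs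
  have hB : 2 * (pd e P p * pd e Q p - pd e a p ^ 2 - pd e b p ^ 2)
      ≤ Real.exp (F p) * pd e F p ^ 2 := by
    refine le_of_mul_le_mul_left ?_ hf
    nlinarith [sq_nonneg (Real.exp (F p) * pd e F p)]
  linarith

/-- At a maximum point, the trace of the Hessian against the (positive) symbol is nonpositive. -/
lemma trace_nonpos_of_max {h : R3 → ℝ} (hh : ContDiff ℝ 2 h) {p : R3} (hmax : ∀ q, h q ≤ h p)
    {P Q a b : ℝ} (hP : 0 < P) (hf : 0 < P * Q - a ^ 2 - b ^ 2) :
    P * (pd vy (pd vy h) p + pd vt (pd vt h) p + pd vt h p) + Q * pd vx (pd vx h) p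
      - 2 * a * pd vy (pd vx h) p - 2 * b * pd vt (pd vx h) p ≤ 0 := by
  have hy := pd_pd_nonpos_of_max hh hmax ((-a) • vx + P • vy)
  have ht := pd_pd_nonpos_of_max hh hmax ((-b) • vx + P • vt)
  have hx := mul_nonpos_of_nonneg_of_nonpos hf.le (pd_pd_nonpos_of_max hh hmax vx)
  rw [pd_pd_combo hh] at hy ht
  rw [pd_eq_zero_of_max hmax vt]
  refine nonpos_of_mul_nonpos_right (a := P) ?_ hP
  linarith

/-- The smallest eigenvalue of the symbol is bounded below by determinant over trace. -/
lemma symbol_lower_bound {P Q a b l : ℝ} (hP : 0 < P) (hQ : 0 < Q) (hl : 0 < l)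
    (h : l * (P + Q) ≤ P * Q - a ^ 2 - b ^ 2) (ξ η τ : ℝ) :
    P * (η ^ 2 + τ ^ 2) + Q * ξ ^ 2 - 2 * a * ξ * η - 2 * b * ξ * τ
      ≥ l * (ξ ^ 2 + η ^ 2 + τ ^ 2) := by
  have hPl : 0 < P - l := by
    refine pos_of_mul_pos_left (b := Q) ?_ hQ.le
    nlinarith [mul_pos hl hP, sq_nonneg a, sq_nonneg b]
  have hdet : 0 ≤ (P - l) * (Q - l) - a ^ 2 - b ^ 2 := by nlinarith [sq_nonneg l]
  refine le_of_sub_nonneg (nonneg_of_mul_nonneg_right (b := _) ?_ hPl)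
  have e : (P - l) * (P * (η ^ 2 + τ ^ 2) + Q * ξ ^ 2 - 2 * a * ξ * η - 2 * b * ξ * τ
      - l * (ξ ^ 2 + η ^ 2 + τ ^ 2)) = ((P - l) * η - a * ξ) ^ 2 + ((P - l) * τ - b * ξ) ^ 2
        + ((P - l) * (Q - l) - a ^ 2 - b ^ 2) * ξ ^ 2 := by ring
  rw [e]
  positivity

end Equation

section APriori

/-- The linearization at `u` of the reduced Calabi–Yau operator, applied to `h`. -/
def linearized (u h : R3 → ℝ) (p : R3) : ℝ :=
  (pd vx (pd vx u) p + 1) * (pd vy (pd vy h) p + pd vt (pd vt h) p + pd vt h p)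
    + (pd vy (pd vy u) p + pd vt (pd vt u) p + pd vt u p + 1) * pd vx (pd vx h) p
    - 2 * pd vy (pd vx u) p * pd vy (pd vx h) p - 2 * pd vt (pd vx u) p * pd vt (pd vx h) p

/-- The trace of the symbol, up to an additive constant. -/
def symbolTrace (u : R3 → ℝ) (p : R3) : ℝ :=
  pd vx (pd vx u) p + pd vy (pd vy u) p + pd vt (pd vt u) p + pd vt u p

variable {F u g h : R3 → ℝ}

lemma linearized_add (hg : ContDiff ℝ 2 g) (hh : ContDiff ℝ 2 h) (p : R3) :
    linearized u (fun q => g q + h q) p = linearized u g p + linearized u h p := by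
  simp only [linearized, pd_pd_add hg hh]
  simp only [pd_add (hg.differentiable (by norm_num)) (hh.differentiable (by norm_num))]
  ring

lemma linearized_sub (hg : ContDiff ℝ 2 g) (hh : ContDiff ℝ 2 h) (p : R3) :
    linearized u (fun q => g q - h q) p = linearized u g p - linearized u h p := by
  simp only [linearized, pd_pd_sub hg hh]
  simp only [pd_sub (hg.differentiable (by norm_num)) (hh.differentiable (by norm_num))]
  ring

lemma CYeq.linearized_self (heq : CYeq F u) (p : R3) :
    linearized u u p = 2 * Real.exp (F p) - (symbolTrace u p + 2) := by
  simp only [linearized, symbolTrace, ← heq p]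
  ring

lemma contDiff_pd_pd (hu : ContDiff ℝ 4 u) (e d : R3) : ContDiff ℝ 2 (pd e (pd d u)) :=
  contDiff_pd (contDiff_pd (m := 3) hu (by norm_num) d) (by norm_num) e

lemma contDiff_symbolTrace (hu : ContDiff ℝ 4 u) : ContDiff ℝ 2 (symbolTrace u) :=
  (((contDiff_pd_pd hu vx vx).add (contDiff_pd_pd hu vy vy)).add (contDiff_pd_pd hu vt vt)).add
    (contDiff_pd hu (by norm_num) vt)

lemma Periodic3.symbolTrace (hp : Periodic3 u) : Periodic3 (symbolTrace u) := by
  intro p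
  have h1 := (hp.pd vx).pd vx p
  have h2 := (hp.pd vy).pd vy p
  have h3 := (hp.pd vt).pd vt p
  have h4 := hp.pd vt p
  simp only [_root_.symbolTrace, h1, h2, h3, h4, and_self]

lemma CYeq.first_factor_pos (heq : CYeq F u) (hu : ContDiff ℝ 4 u) (hp : Periodic3 u) (p : R3) :
    0 < pd vx (pd vx u) p + 1 := by
  have hc := (contDiff_pd_pd hu vx vx).continuous
  have hu2 : ContDiff ℝ 2 u := hu.of_le (by norm_num)
  have hneg : Periodic3 fun q => 0 - u q := fun q => by simp [hp q]
  obtain ⟨m, hm⟩ := hneg.exists_max (continuous_const.sub hu.continuous)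
  have hxx := pd_pd_nonpos_of_max (contDiff_const.sub hu2) hm vx
  rw [pd_pd_sub contDiff_const hu2] at hxx
  simp only [pd_const, zero_sub] at hxx
  by_contra! hle
  obtain ⟨q, hq⟩ := mem_range_of_exists_le_of_exists_ge (c := (0 : ℝ))
    (f := fun q => pd vx (pd vx u) q + 1) (hc.add continuous_const) ⟨p, hle⟩
    ⟨m, by linarith⟩
  have := heq q
  simp only at hq
  rw [hq] at this
  nlinarith [Real.exp_pos (F q), sq_nonneg (pd vy (pd vx u) q), sq_nonneg (pd vt (pd vx u) q)]

lemma CYeq.second_factor_pos (heq : CYeq F u) (hu : ContDiff ℝ 4 u) (hp : Periodic3 u) (p : R3) :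
    0 < pd vy (pd vy u) p + pd vt (pd vt u) p + pd vt u p + 1 := by
  refine pos_of_mul_pos_right (a := pd vx (pd vx u) p + 1) ?_ (heq.first_factor_pos hu hp p).le
  linarith [heq p, Real.exp_pos (F p), sq_nonneg (pd vy (pd vx u) p),
    sq_nonneg (pd vt (pd vx u) p)]

/-- Both factors being positive, the trace of the symbol controls the oscillation of `u`. -/
lemma CYeq.oscillation_le (heq : CYeq F u) (hu : ContDiff ℝ 4 u) (hp : Periodic3 u) {S : ℝ}
    (hS : ∀ p, symbolTrace u p + 2 ≤ S) (p q : R3) : u p ≤ u q + 3 * (S / 16) := by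
  have hu2 : ContDiff ℝ 2 u := hu.of_le (by norm_num)
  have hP := heq.first_factor_pos hu hp
  have hQ := heq.second_factor_pos hu hp
  simp only [symbolTrace] at hS
  have hx := line_diff_le hu2 hp (fun r => (hp r).1) 0 0 (S := S) fun r s => by
    simp only [pd, map_zero]
    simp only [pd] at hP hQ hS
    linarith [hP r, hP s, hQ r, hQ s, hS r, hS s]
  have hy := line_diff_le hu2 hp (fun r => (hp r).2.1) vt vt (S := S) fun r s => by
    linarith [hP r, hP s, hQ r, hQ s, hS r, hS s]
  have ht := line_diff_le hu2 hp (fun r => (hp r).2.2) vy vt (S := S) fun r s => by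
    linarith [hP r, hP s, hQ r, hQ s, hS r, hS s]
  have e : q + (p.1 - q.1) • vx + (p.2.1 - q.2.1) • vy + (p.2.2 - q.2.2) • vt = p := by
    ext <;> simp [vx, vy, vt]
  have h1 := hx q (p.1 - q.1)
  have h2 := hy (q + (p.1 - q.1) • vx) (p.2.1 - q.2.1)
  have h3 := ht (q + (p.1 - q.1) • vx + (p.2.1 - q.2.1) • vy) (p.2.2 - q.2.2)
  rw [e] at h3
  linarith

lemma CYeq.linearized_second (heq : CYeq F u) (hF : ContDiff ℝ 2 F) (hu : ContDiff ℝ 4 u)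
    (hp : Periodic3 u) (e p : R3) :
    Real.exp (F p) * pd e (pd e F) p ≤ linearized u (pd e (pd e u)) p := by
  have hut : ContDiff ℝ 2 (pd vt u) := contDiff_pd hu (by norm_num) vt
  have hyt := (contDiff_pd_pd hu vy vy).add (contDiff_pd_pd hu vt vt)
  have key := second_variation ((contDiff_pd_pd hu vx vx).add contDiff_const)
    ((hyt.add hut).add contDiff_const) (contDiff_pd_pd hu vy vx) (contDiff_pd_pd hu vt vx) hF heq
    (heq.first_factor_pos hu hp) e p
  simp only [pd_add_const, pd_pd_add hyt hut,
    pd_pd_add (contDiff_pd_pd hu vy vy) (contDiff_pd_pd hu vt vt), pd_comm_four hu e] at key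
  rw [← pd_comm_three hu vt e e] at key
  simp only [linearized]
  linarith

lemma CYeq.linearized_first (heq : CYeq F u) (hF : ContDiff ℝ 2 F) (hu : ContDiff ℝ 4 u) (p : R3) :
    linearized u (pd vt u) p = Real.exp (F p) * pd vt F p := by
  have d0 : ∀ {g : R3 → ℝ}, ContDiff ℝ 2 g → Differentiable ℝ g :=
    fun hg => hg.differentiable (by norm_num)
  have dd : ∀ e d, Differentiable ℝ (pd e (pd d u)) := fun e d => d0 (contDiff_pd_pd hu e d)
  have dt : Differentiable ℝ (pd vt u) := d0 (contDiff_pd hu (by norm_num) vt)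
  have hyt := (dd vy vy).fun_add (dd vt vt)
  have key := first_variation ((dd vx vx).add_const 1) ((hyt.fun_add dt).add_const 1)
    (dd vy vx) (dd vt vx) (d0 hF) heq vt p
  simp only [pd_add_const, pd_add hyt dt, pd_add (dd vy vy) (dd vt vt),
    pd_comm_three hu vt] at key
  simp only [linearized]
  rw [pd_comm (contDiff_pd hu (by norm_num) vt) vt vx]
  linarith

lemma CYeq.linearized_symbolTrace (heq : CYeq F u) (hF : ContDiff ℝ 2 F) (hu : ContDiff ℝ 4 u)
    (hp : Periodic3 u) {K : ℝ} (hK : C2Bound F K) (p : R3) :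
    -(4 * K * Real.exp K) ≤ linearized u (symbolTrace u) p := by
  have hut : ContDiff ℝ 2 (pd vt u) := contDiff_pd hu (by norm_num) vt
  have hxy := (contDiff_pd_pd hu vx vx).add (contDiff_pd_pd hu vy vy)
  have hxyt := hxy.add (contDiff_pd_pd hu vt vt)
  have hsum : linearized u (symbolTrace u) p = linearized u (pd vx (pd vx u)) p
      + linearized u (pd vy (pd vy u)) p + linearized u (pd vt (pd vt u)) p
      + linearized u (pd vt u) p := by
    rw [← linearized_add (contDiff_pd_pd hu vx vx) (contDiff_pd_pd hu vy vy),
      ← linearized_add hxy (contDiff_pd_pd hu vt vt), ← linearized_add hxyt hut]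
    rfl
  obtain ⟨h0, h1, h2⟩ := hK p
  have hx := (abs_le.1 (h2 vx (by simp) vx (by simp))).1
  have hy := (abs_le.1 (h2 vy (by simp) vy (by simp))).1
  have ht := (abs_le.1 (h2 vt (by simp) vt (by simp))).1
  have ht1 := (abs_le.1 (h1 vt (by simp))).1
  have hK0 : 0 ≤ K := (abs_nonneg _).trans h0
  have hexp : Real.exp (F p) ≤ Real.exp K := Real.exp_le_exp.2 (abs_le.1 h0).2
  rw [hsum, heq.linearized_first hF hu]
  have hsx := heq.linearized_second hF hu hp vx p
  have hsy := heq.linearized_second hF hu hp vy p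
  have hst := heq.linearized_second hF hu hp vt p
  have := mul_le_mul_of_nonneg_left hexp hK0
  have := mul_le_mul_of_nonneg_left (show -(4 * K) ≤ pd vx (pd vx F) p + pd vy (pd vy F) p
    + pd vt (pd vt F) p + pd vt F p by linarith) (Real.exp_pos (F p)).le
  linarith

/-- A priori bound of the trace of the symbol: the maximum principle applied to
`symbolTrace u - u`, with the oscillation of `u` absorbed. -/
lemma CYeq.symbolTrace_le (heq : CYeq F u) (hF : ContDiff ℝ 2 F) (hu : ContDiff ℝ 4 u)
    (hp : Periodic3 u) {K : ℝ} (hK : C2Bound F K) (p : R3) :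
    symbolTrace u p + 2 ≤ (4 + 8 * K) * Real.exp K := by
  have hu2 : ContDiff ℝ 2 u := hu.of_le (by norm_num)
  have hW := contDiff_symbolTrace hu
  have hWp := hp.symbolTrace
  obtain ⟨m, hm⟩ := hWp.exists_max hW.continuous
  have hdiff : Periodic3 fun q => symbolTrace u q - u q := fun q => by simp [hp q, hWp q]
  obtain ⟨z, hz⟩ := hdiff.exists_max (hW.sub hu2).continuous
  have hosc := heq.oscillation_le hu hp (S := symbolTrace u m + 2) (by simpa using hm) m z
  have hLz : linearized u (fun q => symbolTrace u q - u q) z ≤ 0 :=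
    trace_nonpos_of_max (hW.sub hu2) hz (heq.first_factor_pos hu hp z)
      ((heq z).symm ▸ Real.exp_pos (F z))
  rw [linearized_sub hW hu2, heq.linearized_self] at hLz
  have hLW := heq.linearized_symbolTrace hF hu hp hK z
  have hexp : Real.exp (F z) ≤ Real.exp K := Real.exp_le_exp.2 (abs_le.1 (hK z).1).2
  have hmz := hz m
  have hK0 : 0 ≤ K := (abs_nonneg _).trans (hK p).1
  have := hm p
  have : 0 ≤ K * Real.exp K := by positivity
  linarith [Real.exp_pos K]

end APriori

/-- Uniform ellipticity: for every `K > 0` there is `λ > 0`,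
depending only on `K`, such that the principal symbol of the linearization of
the reduced Calabi–Yau equation at any `C⁴` solution `u` (with `‖F‖_{C²} ≤ K` and
`∫ e^F = 1`) dominates `λ (ξ² + η² + τ²)`. -/
theorem stmt13 (K : ℝ) (hK : 0 < K) :
    ∃ lam : ℝ, 0 < lam ∧
      ∀ F u : R3 → ℝ,
        ContDiff ℝ 2 F → Periodic3 F → C2Bound F K →
        (∫ p in cube, Real.exp (F p)) = 1 →
        ContDiff ℝ 4 u → Periodic3 u → ZeroMean u → CYeq F u →
        ∀ p : R3, ∀ ξ η τ : ℝ,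
          (pd vx (pd vx u) p + 1) * (η ^ 2 + τ ^ 2)
              + (pd vy (pd vy u) p + pd vt (pd vt u) p + pd vt u p + 1) * ξ ^ 2
              - 2 * pd vy (pd vx u) p * ξ * η - 2 * pd vt (pd vx u) p * ξ * τ
            ≥ lam * (ξ ^ 2 + η ^ 2 + τ ^ 2) := by
  have hC : 0 < (4 + 8 * K) * Real.exp K := by positivity
  refine ⟨Real.exp (-K) / ((4 + 8 * K) * Real.exp K), by positivity, ?_⟩
  intro F u hF _ hFK _ hu hup _ heq p ξ η τ
  refine symbol_lower_bound (heq.first_factor_pos hu hup p) (heq.second_factor_pos hu hup p)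
    (by positivity) ?_ ξ η τ
  have htrace := heq.symbolTrace_le hF hu hup hFK p
  have hexp : Real.exp (-K) ≤ Real.exp (F p) := Real.exp_le_exp.2 (abs_le.1 (hFK p).1).1
  rw [heq p, div_mul_eq_mul_div, div_le_iff₀ hC]
  simp only [symbolTrace] at htrace
  refine (mul_le_mul_of_nonneg_left ?_ (Real.exp_pos _).le).trans
    (mul_le_mul_of_nonneg_right hexp hC.le)
  linarith

end
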